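/- Let a, b, c, p be integers with 0 ≤ p ≤ a, b > 1 and c > 1 + p. Then E(a,b,c,1,p) = ( ∏_{i=0}^{p−1} i!·(b+c−1+i)! / ((b−1+i)!·(a+c−p+i)!) ) · ( ∏_{i=p}^{a−1} i!·(b+c−1+i)! / ((b+i)!·(c−1−p+i)!) ) · ( (a−p+1)_p / p! ), where (x)_n denotes the Pochhammer symbol (rising factorial). -/

import Mathlib

open Finset

noncomputable section

/-- Binomial coefficient with integer arguments, equal to `0` whenever `k < 0` or `k > n`. -/
def ibinom (n k : ℤ) : ℚ :=
  if 0 ≤ k ∧ k ≤ n then (n.toNat.choose k.toNat : ℚ) else 0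

/-- The Pochhammer symbol (rising factorial) `x (x+1) ⋯ (x+n-1)`. -/
def poch (x : ℚ) (n : ℕ) : ℚ := (ascPochhammer ℚ n).eval x

/-- MacMahon's product `M(a,b,c)`. -/
def macmahon (a b c : ℕ) : ℚ :=
  ∏ i ∈ Finset.range a,
    ((Nat.factorial i : ℚ) * (Nat.factorial (b + c + i) : ℚ)) /
      ((Nat.factorial (b + i) : ℚ) * (Nat.factorial (c + i) : ℚ))

/-- The matrix `Q(a,b,c,d,p)` (with `1`-based indices `i, j ∈ {1, …, a+d}`):
rows/columns with index `≤ a` are lateral, the rest are intrusive. -/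
def Qmat (a b c d : ℕ) (p : ℤ) : Matrix (Fin (a + d)) (Fin (a + d)) ℚ :=
  Matrix.of fun i j =>
    if (i : ℕ) < a then
      if (j : ℕ) < a then
        ibinom ((b : ℤ) + c) ((c : ℤ) - (((i : ℕ) : ℤ) + 1) + (((j : ℕ) : ℤ) + 1))
      else
        ibinom (2 * (((j : ℕ) : ℤ) - a + 1) - 1)
          ((((j : ℕ) : ℤ) - a + 1) - (((i : ℕ) : ℤ) + 1) + p)
    else
      if (j : ℕ) < a then
        ibinom ((b : ℤ) + c - 2 * (((i : ℕ) : ℤ) - a + 1) + 1)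
          ((c : ℤ) - (((i : ℕ) : ℤ) - a + 1) + (((j : ℕ) : ℤ) + 1) - p)
      else
        ibinom (2 * (((j : ℕ) : ℤ) - ((i : ℕ) : ℤ))) (((j : ℕ) : ℤ) - ((i : ℕ) : ℤ))

/-- `E(a,b,c,d,p) = det Q(a,b,c,d,p)`, the signed count of lozenge tilings of the
`(a,b,c)`-hexagon with an even intrusion of length `d` at position `p`. -/
def E (a b c d : ℕ) (p : ℤ) : ℚ := (Qmat a b c d p).det


lemma ibinom_nat (n k : ℕ) : ibinom (n : ℤ) (k : ℤ) = (n.choose k : ℚ) := by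
  unfold ibinom
  by_cases h : k ≤ n
  · rw [if_pos ⟨by omega, by omega⟩]; simp
  · rw [if_neg (by omega), Nat.choose_eq_zero_of_lt (by omega)]; simp

lemma ibinom_neg (n k : ℤ) (h : k < 0) : ibinom n k = 0 := by
  unfold ibinom
  rw [if_neg (by omega)]

lemma ibinom_pascal (n : ℕ) (k : ℤ) :
    ibinom ((n : ℤ) + 1) k = ibinom n k + ibinom n (k - 1) := by
  rcases lt_trichotomy k 0 with h | h | h
  · rw [ibinom_neg _ _ h, ibinom_neg _ _ h, ibinom_neg _ _ (by omega)]; simp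
  · subst h
    rw [ibinom_neg _ (0 - 1) (by omega)]
    have h1 := ibinom_nat (n + 1) 0
    have h2 := ibinom_nat n 0
    push_cast at h1 h2
    rw [h1, h2]; simp
  · obtain ⟨m, rfl⟩ : ∃ m : ℕ, k = m + 1 := ⟨(k - 1).toNat, by omega⟩
    have h1 := ibinom_nat (n + 1) (m + 1)
    have h2 := ibinom_nat n (m + 1)
    have h3 := ibinom_nat n m
    push_cast at h1 h2
    rw [h1, h2, add_sub_cancel_right, h3, Nat.choose_succ_succ]; push_cast; ring

lemma ibinom_conv (s : ℕ) : ∀ (n : ℕ) (k : ℤ),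
    ∑ l ∈ range (s + 1), ibinom n (k - l) * (s.choose l : ℚ) = ibinom ((n : ℤ) + s) k := by
  induction s with
  | zero => intro n k; simp
  | succ s ih =>
    intro n k
    have h := ih (n + 1) k
    have e : ((n : ℤ) + (s + 1 : ℕ)) = ((n + 1 : ℕ) : ℤ) + s := by push_cast; ring
    rw [e, ← h, sum_range_succ']
    have h2 : ∀ l : ℕ, ibinom ((n + 1 : ℕ) : ℤ) (k - l)
        = ibinom n (k - l) + ibinom n (k - (l + 1 : ℕ)) := by
      intro l
      have := ibinom_pascal n (k - l)
      push_cast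
      rw [this]; congr 2; ring
    simp only [h2, Nat.choose_succ_succ, Nat.cast_add (R := ℚ), mul_add, add_mul, sum_add_distrib]
    have h3 : ∑ l ∈ range (s + 1), ibinom n (k - l) * (s.choose l : ℚ)
       = ∑ l ∈ range (s + 1), ibinom n (k - (l + 1 : ℕ)) * (s.choose (l + 1) : ℚ)
         + ibinom n (k - (0 : ℕ)) := by
      rw [← add_zero (∑ l ∈ range (s + 1), ibinom n (k - l) * (s.choose l : ℚ))]
      have := sum_range_succ' (fun l : ℕ => ibinom n (k - l) * (s.choose l : ℚ)) (s + 1)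
      rw [sum_range_succ] at this
      simpa using this
    rw [h3]
    simp
    ring

/-- Column operations. -/
lemma det_col (a n : ℕ) (M : Fin a → ℕ) :
    (Matrix.of fun r k : Fin a => ibinom n ((M r : ℤ) - (k : ℕ))).det =
    (Matrix.of fun r k : Fin a => ibinom ((n + (a - 1 - k) : ℕ) : ℤ) ((M r : ℤ) - (k : ℕ))).det := by
  set T : Matrix (Fin a) (Fin a) ℚ := Matrix.of fun x k =>
    if (k : ℕ) ≤ x then ((a - 1 - k).choose (x - k) : ℚ) else 0 with hT
  have hdet : T.det = 1 := by
    rw [Matrix.det_of_isLowerTriangular]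
    · simp [hT]
    · intro i j hij
      have : i < j := hij
      simp [hT, this]
  have hmul : (Matrix.of fun r k : Fin a => ibinom n ((M r : ℤ) - (k : ℕ))) * T =
    (Matrix.of fun r k : Fin a => ibinom ((n + (a - 1 - k) : ℕ) : ℤ) ((M r : ℤ) - (k : ℕ))) := by
    ext r k
    rw [Matrix.mul_apply]
    simp only [hT, Matrix.of_apply]
    rw [Fin.sum_univ_eq_sum_range (fun x : ℕ => ibinom n ((M r : ℤ) - x) *
      (if (k : ℕ) ≤ x then ((a - 1 - k).choose (x - k) : ℚ) else 0)) a]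
    obtain ⟨s, hs⟩ : ∃ s : ℕ, a = k + (s + 1) := ⟨a - 1 - k, by omega⟩
    have hs' : a - 1 - (k : ℕ) = s := by omega
    rw [hs']
    have hr : range a = range ((k : ℕ) + (s + 1)) := by rw [← hs]
    rw [hr, Finset.sum_range_add, sum_eq_zero, zero_add]
    · push_cast
      rw [← ibinom_conv]
      apply sum_congr rfl
      intro l _
      simp only [le_add_iff_nonneg_right, zero_le, if_true, add_tsub_cancel_left]
      push_cast
      congr 2; ring
    · intro x hx
      rw [mem_range] at hx
      rw [if_neg (by omega), mul_zero]
  rw [← hmul, Matrix.det_mul, hdet, mul_one]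

lemma entry (N k m : ℕ) (hm : m ≤ N) (hk : k ≤ N) :
    ibinom ((N - k : ℕ) : ℤ) ((m : ℤ) - k) =
      (1 / ((m.factorial : ℚ) * (N - m).factorial)) * (((descPochhammer ℚ k).eval (m : ℚ)) *
        ((N - k).factorial : ℚ)) := by
  rw [descPochhammer_eval_eq_descFactorial]
  by_cases h : k ≤ m
  · have : (m : ℤ) - k = ((m - k : ℕ) : ℤ) := by omega
    rw [this, ibinom_nat, Nat.cast_choose ℚ (by omega)]
    have h1 := Nat.factorial_mul_descFactorial h
    have h2 : N - k - (m - k) = N - m := by omega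
    rw [h2]
    have h3 : (m.factorial : ℚ) = ((m - k).factorial : ℚ) * (m.descFactorial k : ℚ) := by
      exact_mod_cast h1.symm
    have h4 : (m.factorial : ℚ) ≠ 0 := by exact_mod_cast Nat.factorial_ne_zero _
    have h5 : ((m - k).factorial : ℚ) ≠ 0 := by exact_mod_cast Nat.factorial_ne_zero _
    have h6 : ((N - m).factorial : ℚ) ≠ 0 := by exact_mod_cast Nat.factorial_ne_zero _
    field_simp
    rw [h3]
  · rw [ibinom_neg _ _ (by omega), Nat.descFactorial_eq_zero_iff_lt.2 (by omega)]; simp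

lemma det_binom (a n : ℕ) (M : Fin a → ℕ) (hM : ∀ r, M r ≤ n + a - 1) :
    (Matrix.of fun r k : Fin a => ibinom n ((M r : ℤ) - (k : ℕ))).det =
    (∏ r : Fin a, (1 / (((M r).factorial : ℚ) * (n + a - 1 - M r).factorial))) *
    ((∏ k : Fin a, ((n + a - 1 - k).factorial : ℚ)) *
      ∏ i : Fin a, ∏ j ∈ Ioi i, ((M j : ℚ) - (M i : ℚ))) := by
  rw [det_col]
  have h1 : (Matrix.of fun r k : Fin a =>
        ibinom ((n + (a - 1 - k) : ℕ) : ℤ) ((M r : ℤ) - (k : ℕ))) =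
      Matrix.of fun r k => (1 / (((M r).factorial : ℚ) * (n + a - 1 - M r).factorial)) *
        (Matrix.of (fun r k : Fin a => ((n + a - 1 - k).factorial : ℚ) *
          (Matrix.of fun (r k : Fin a) => (descPochhammer ℚ k).eval (M r : ℚ)) r k)) r k := by
    ext r k
    have := k.2
    have e : n + (a - 1 - (k : ℕ)) = n + a - 1 - k := by omega
    simp only [Matrix.of_apply]
    rw [e, entry _ _ _ (hM r) (by omega)]; ring
  rw [h1, Matrix.det_mul_column, Matrix.det_mul_row]
  congr 2
  rw [← Matrix.det_vandermonde]
  refine (Matrix.det_eval_matrixOfPolynomials_eq_det_vandermonde (fun r => (M r : ℚ))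
    (fun k => descPochhammer ℚ k) ?_ ?_).symm
  · intro i; simp
  · intro i; exact monic_descPochhammer ℚ i

lemma prod_Ioi_range (a : ℕ) (f : ℕ → ℕ → ℚ) :
    ∏ i : Fin a, ∏ j ∈ Ioi i, f i j = ∏ j ∈ range a, ∏ i ∈ range j, f i j := by
  have h1 : ∀ i : Fin a, ∏ j ∈ Ioi i, f i j = ∏ j : Fin a, if (i : ℕ) < j then f i j else 1 := by
    intro i
    rw [← prod_filter]
    apply prod_congr _ (fun _ _ => rfl)
    ext j; simp
  simp only [h1]
  rw [prod_comm, ← Fin.prod_univ_eq_prod_range (fun j => ∏ i ∈ range j, f i j) a]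
  apply prod_congr rfl
  intro j _
  rw [Fin.prod_univ_eq_prod_range (fun i => if i < (j : ℕ) then f i j else 1) a, ← prod_filter]
  apply prod_congr _ (fun _ _ => rfl)
  ext i
  have := j.2
  simp only [mem_filter, mem_range]
  omega

def vsk (q i : ℕ) : ℕ := if i < q then i else i + 1

lemma prod_skip (q : ℕ) (g : ℕ → ℚ) (j : ℕ) (hj : q ≤ j) :
    (∏ i ∈ range j, g (vsk q i)) * g q = ∏ i ∈ range (j + 1), g i := by
  induction j, hj using Nat.le_induction with
  | base =>
    rw [prod_range_succ]
    congr 1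
    apply prod_congr rfl
    intro i hi
    rw [mem_range] at hi
    simp [vsk, hi]
  | succ j hj ih =>
    rw [prod_range_succ, prod_range_succ _ (j + 1), ← ih]
    have : vsk q j = j + 1 := by simp [vsk, hj]
    rw [this]; ring

lemma prod_fact (j : ℕ) : ∏ i ∈ range j, ((j : ℚ) - i) = j.factorial := by
  induction j with
  | zero => simp
  | succ j ih =>
    rw [prod_range_succ', Nat.factorial_succ]
    push_cast
    rw [← ih]
    simp only [add_sub_add_right_eq_sub, sub_zero]
    ring

lemma vdm_skip (q a : ℕ) (h : q ≤ a) :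
    (∏ j ∈ range a, ∏ i ∈ range j, ((vsk q j : ℚ) - vsk q i)) *
      ((q.factorial : ℚ) * (a - q).factorial) =
    (∏ i ∈ range a, (i.factorial : ℚ)) * a.factorial := by
  induction a, h using Nat.le_induction with
  | base =>
    simp only [Nat.sub_self, Nat.factorial_zero, Nat.cast_one, mul_one]
    congr 1
    apply prod_congr rfl
    intro j hj
    rw [mem_range] at hj
    rw [← prod_fact]
    apply prod_congr rfl
    intro i hi
    rw [mem_range] at hi
    have : i < q := by omega
    simp [vsk, hj, this]
  | succ a h ih =>
    rw [prod_range_succ, prod_range_succ]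
    have e : a + 1 - q = (a - q) + 1 := by omega
    rw [e, Nat.factorial_succ (a - q)]
    have h1 := prod_skip q (fun x => ((a + 1 : ℕ) : ℚ) - x) a h
    rw [prod_fact] at h1
    have h2 : vsk q a = a + 1 := by simp [vsk, h]
    rw [h2, ← h1]
    have h3 : (((a - q + 1 : ℕ)) : ℚ) = ((a + 1 : ℕ) : ℚ) - q := by
      rw [← Nat.cast_sub (by omega)]; congr 1; omega
    push_cast at h3 ih ⊢
    rw [h3]
    linear_combination ((a : ℚ) + 1 - q) *
      (∏ x ∈ range a, ((a : ℚ) + 1 - (vsk q x : ℚ))) * ih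

/-- Row operations. -/
lemma E_eq_det (a b c p : ℕ) (hp : p ≤ a) (hb : 1 < b) (hc : 1 + p < c) :
    E a b c 1 (p : ℤ) = (Matrix.of fun i j : Fin a => ibinom ((b + c - 1 : ℕ) : ℤ)
      ((c : ℤ) + (j : ℕ) - (vsk p i : ℕ))).det := by
  set R' : Matrix (Fin a) (Fin a) ℚ := Matrix.of fun i j : Fin a => ibinom ((b + c - 1 : ℕ) : ℤ)
      ((c : ℤ) + (j : ℕ) - (vsk p i : ℕ)) with hR'
  set V : Matrix (Fin 1) (Fin a) ℚ := Matrix.of fun _ j => ibinom ((b + c - 1 : ℕ) : ℤ)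
      ((c : ℤ) + (j : ℕ) - p) with hV
  set L' : Matrix (Fin a) (Fin a) ℚ := Matrix.of fun i j =>
    if i = j then 1 else if (j : ℕ) = i + 1 ∧ (j : ℕ) < p then 1 else
      if (j : ℕ) + 1 = i ∧ p ≤ (j : ℕ) then 1 else 0 with hL'
  set U : Matrix (Fin a) (Fin 1) ℚ := Matrix.of fun i _ =>
    if (i : ℕ) + 1 = p ∨ (i : ℕ) = p then 1 else 0 with hU
  have hLdet : L'.det = 1 := by
    have hbt : L'.BlockTriangular (fun i : Fin a =>
        OrderDual.toDual (if (i : ℕ) < p then p - i else i - p)) := by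
      intro i j hij
      have hij' : (if (i : ℕ) < p then p - (i : ℕ) else i - p) <
         (if (j : ℕ) < p then p - (j : ℕ) else j - p) := hij
      simp only [hL', Matrix.of_apply]
      have h1 : i ≠ j := by rintro rfl; exact lt_irrefl _ hij'
      rw [if_neg h1, if_neg, if_neg]
      · rintro ⟨h2, h3⟩
        split_ifs at hij' <;> omega
      · rintro ⟨h2, h3⟩
        split_ifs at hij' <;> omega
    rw [hbt.det]
    apply prod_eq_one
    intro k _
    have : L'.toSquareBlock (fun i : Fin a =>
        OrderDual.toDual (if (i : ℕ) < p then p - i else i - p)) k = 1 := by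
      ext ⟨i, hi⟩ ⟨j, hj⟩
      simp only [Matrix.toSquareBlock_def, Matrix.of_apply, hL', Matrix.one_apply, Subtype.mk.injEq]
      have hij : (if (i : ℕ) < p then p - (i : ℕ) else i - p) =
         (if (j : ℕ) < p then p - (j : ℕ) else j - p) :=
        OrderDual.toDual.injective (hi.trans hj.symm)
      by_cases h1 : i = j
      · simp [h1]
      · rw [if_neg h1, if_neg h1, if_neg, if_neg]
        · rintro ⟨h2, h3⟩
          split_ifs at hij <;> omega
        · rintro ⟨h2, h3⟩
          split_ifs at hij <;> omega
    rw [this, Matrix.det_one]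
  have hQ : (Qmat a b c 1 (p : ℤ)).submatrix finSumFinEquiv finSumFinEquiv =
      Matrix.fromBlocks L' U 0 1 * Matrix.fromBlocks R' 0 V 1 := by
    rw [Matrix.fromBlocks_multiply]
    have pas : ∀ k : ℤ, ibinom ((b : ℤ) + c) k = ibinom ((b + c - 1 : ℕ) : ℤ) k +
        ibinom ((b + c - 1 : ℕ) : ℤ) (k - 1) := by
      intro k
      rw [← ibinom_pascal]; congr 1; omega
    ext i j
    rcases i with i | i <;> rcases j with j | j
    · have hi := i.2
      have hj := j.2
      simp only [Matrix.submatrix_apply, finSumFinEquiv_apply_left, Matrix.fromBlocks_apply₁₁,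
        Qmat, Matrix.of_apply, Fin.val_castAdd, hi, hj, if_true, Matrix.add_apply,
        Matrix.mul_apply, Fin.sum_univ_one]
      rw [pas]
      by_cases c1 : (i : ℕ) + 1 = p ∨ (i : ℕ) = p
      · have hs : ∀ x : Fin a, L' i x * R' x j = if i = x then R' x j else 0 := by
          intro x
          simp only [hL', Matrix.of_apply]
          by_cases hx : i = x
          · simp [hx]
          · rw [if_neg hx, if_neg hx, if_neg (by omega), if_neg (by omega), zero_mul]
        simp only [hs, sum_ite_eq, mem_univ, if_true]
        simp only [hU, hV, hR', Matrix.of_apply, if_pos c1, one_mul, vsk]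
        rcases c1 with c1 | c1
        · rw [if_pos (by omega)]
          congr 2 <;> omega
        · rw [if_neg (by omega), add_comm]
          congr 2 <;> omega
      · obtain ⟨y, hy1, hy2⟩ : ∃ y : Fin a, i ≠ y ∧
            (((y : ℕ) = i + 1 ∧ (y : ℕ) < p) ∨ ((y : ℕ) + 1 = i ∧ p ≤ (y : ℕ))) := by
          by_cases c2 : (i : ℕ) < p
          · refine ⟨⟨i + 1, by omega⟩, ?_, Or.inl ⟨rfl, ?_⟩⟩
            · intro h; have := congrArg Fin.val h; simp at this
            · simp only; omega
          · refine ⟨⟨i - 1, by omega⟩, ?_, Or.inr ⟨?_, ?_⟩⟩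
            · intro h; have := congrArg Fin.val h; simp at this; omega
            · simp only; omega
            · simp only; omega
        have hs : ∀ x : Fin a, L' i x * R' x j = (if i = x then R' x j else 0) +
            (if y = x then R' x j else 0) := by
          intro x
          simp only [hL', Matrix.of_apply]
          by_cases hx : i = x
          · subst hx
            simp [hy1.symm]
          · rw [if_neg hx, if_neg hx, zero_add]
            by_cases hxy : y = x
            · subst hxy
              rw [if_pos rfl]
              rcases hy2 with hy2 | hy2
              · rw [if_pos hy2, one_mul]
              · rw [if_neg (by omega), if_pos hy2, one_mul]
            · have hne : (y : ℕ) ≠ x := fun h => hxy (Fin.ext h)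
              rw [if_neg hxy, if_neg (by omega), if_neg (by omega), zero_mul]
        simp only [hs, sum_add_distrib, sum_ite_eq, mem_univ, if_true]
        simp only [hU, hV, hR', Matrix.of_apply, if_neg c1, zero_mul, add_zero, vsk]
        rcases hy2 with ⟨h2, h3⟩ | ⟨h2, h3⟩
        · rw [if_pos (by omega), if_pos (by omega)]
          congr 2 <;> omega
        · rw [if_neg (by omega), if_neg (by omega), add_comm]
          congr 2 <;> omega
    · have hi := i.2
      have hj := j.2
      have : j = 0 := Subsingleton.elim _ _
      subst this
      simp [Qmat, hU, ibinom]
      split_ifs <;> first | rfl | omega | skip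
      rename_i h5 h6
      obtain h7 | h7 : (-((i : ℕ) : ℤ) + p).toNat = 1 ∨ (-((i : ℕ) : ℤ) + p).toNat = 0 := by omega
      · rw [h7]; simp
      · rw [h7]; simp
    · have hi := i.2
      have hj := j.2
      have : i = 0 := Subsingleton.elim _ _
      subst this
      simp [Qmat, hV]
      congr 1 <;> omega
    · have : i = 0 := Subsingleton.elim _ _
      subst this
      have : j = 0 := Subsingleton.elim _ _
      subst this
      simp [Qmat, ibinom]
  unfold E
  rw [← Matrix.det_submatrix_equiv_self (finSumFinEquiv (m := a) (n := 1)), hQ, Matrix.det_mul,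
    Matrix.det_fromBlocks_zero₂₁, Matrix.det_fromBlocks_zero₁₂, hLdet]
  simp

lemma poch_eq (a p : ℕ) (hp : p ≤ a) :
    poch ((a : ℚ) - p + 1) p * (a - p).factorial = a.factorial := by
  unfold poch
  have h := Nat.factorial_mul_ascFactorial (a - p) p
  have e : (a : ℚ) - p + 1 = ((a - p + 1 : ℕ) : ℚ) := by push_cast [hp]; ring
  rw [e, ascPochhammer_nat_eq_natCast_ascFactorial, mul_comm]
  rw [Nat.sub_add_cancel hp] at h
  exact_mod_cast h

/-- Product formula for `E(a,b,c,1,p)` for `0 ≤ p ≤ a`, `b > 1`, `c > 1 + p`. -/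
theorem E_d_one_product (a b c p : ℕ) (hp : p ≤ a) (hb : 1 < b) (hc : 1 + p < c) :
    E a b c 1 (p : ℤ) =
      (∏ i ∈ Finset.range p,
          ((Nat.factorial i : ℚ) * (Nat.factorial (b + c - 1 + i) : ℚ)) /
            ((Nat.factorial (b - 1 + i) : ℚ) * (Nat.factorial (a + c - p + i) : ℚ))) *
      (∏ i ∈ Finset.Ico p a,
          ((Nat.factorial i : ℚ) * (Nat.factorial (b + c - 1 + i) : ℚ)) /
            ((Nat.factorial (b + i) : ℚ) * (Nat.factorial (c - 1 - p + i) : ℚ))) *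
      (poch ((a : ℚ) - p + 1) p / (Nat.factorial p : ℚ)) := by
  rw [E_eq_det a b c p hp hb hc, ← Matrix.det_submatrix_equiv_self Fin.revPerm]
  set M : ℕ → ℕ := fun r => c - 1 + vsk (a - p) r with hM
  have h1 : (Matrix.of fun i j : Fin a => ibinom ((b + c - 1 : ℕ) : ℤ)
      ((c : ℤ) + (j : ℕ) - (vsk p i : ℕ))).submatrix Fin.revPerm Fin.revPerm =
      Matrix.of fun r k : Fin a => ibinom ((b + c - 1 : ℕ) : ℤ) ((M r : ℤ) - (k : ℕ)) := by
    ext r k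
    have := r.2
    have := k.2
    simp only [Matrix.submatrix_apply, Matrix.of_apply, Fin.revPerm_apply, Fin.val_rev, hM, vsk]
    congr 1
    split_ifs <;> omega
  rw [h1, det_binom a (b + c - 1) (fun r => M r)]
  swap
  · intro r
    have := r.2
    simp only [hM, vsk]
    split_ifs <;> omega
  rw [prod_Ioi_range a (fun i j => ((M j : ℕ) : ℚ) - ((M i : ℕ) : ℚ)),
    Fin.prod_univ_eq_prod_range (fun r => 1 / (((M r).factorial : ℚ) *
      (b + c - 1 + a - 1 - M r).factorial)) a,
    Fin.prod_univ_eq_prod_range (fun k => ((b + c - 1 + a - 1 - k).factorial : ℚ)) a]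
  have hv := vdm_skip (a - p) a (by omega)
  have e1 : ∏ j ∈ range a, ∏ i ∈ range j, (((M j : ℕ) : ℚ) - ((M i : ℕ) : ℚ)) =
      ∏ j ∈ range a, ∏ i ∈ range j, ((vsk (a - p) j : ℚ) - vsk (a - p) i) := by
    apply prod_congr rfl
    intro j _
    apply prod_congr rfl
    intro i _
    simp only [hM]
    push_cast
    ring
  rw [e1]
  have e2 : ∏ k ∈ range a, ((b + c - 1 + a - 1 - k).factorial : ℚ) =
      ∏ i ∈ range a, ((b + c - 1 + i).factorial : ℚ) := by
    rw [← prod_range_reflect]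
    apply prod_congr rfl
    intro i hi
    rw [mem_range] at hi
    congr 2; omega
  rw [e2]
  have e3 : ∏ r ∈ range a, (1 / (((M r).factorial : ℚ) * (b + c - 1 + a - 1 - M r).factorial)) =
      (∏ i ∈ range p, (1 / (((b - 1 + i).factorial : ℚ) * (a + c - p + i).factorial))) *
      ∏ i ∈ Ico p a, (1 / (((b + i).factorial : ℚ) * (c - 1 - p + i).factorial)) := by
    have hr : range a = range ((a - p) + p) := by rw [Nat.sub_add_cancel hp]
    simp only [one_div, mul_inv, prod_mul_distrib]
    rw [hr, prod_range_add, prod_range_add, prod_Ico_eq_prod_range, prod_Ico_eq_prod_range]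
    rw [← prod_range_reflect (fun i => ((b - 1 + i).factorial : ℚ)⁻¹) p,
      ← prod_range_reflect (fun i => ((b + (p + i)).factorial : ℚ)⁻¹) (a - p)]
    have f1 : ∏ x ∈ range (a - p), ((M x).factorial : ℚ)⁻¹ =
        ∏ k ∈ range (a - p), ((c - 1 - p + (p + k)).factorial : ℚ)⁻¹ := by
      apply prod_congr rfl
      intro i hi
      rw [mem_range] at hi
      simp only [hM, vsk, hi, if_true]
      congr 3; omega
    have f2 : ∏ x ∈ range p, ((M (a - p + x)).factorial : ℚ)⁻¹ =
        ∏ x ∈ range p, ((a + c - p + x).factorial : ℚ)⁻¹ := by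
      apply prod_congr rfl
      intro i hi
      rw [mem_range] at hi
      have : ¬ (a - p + i < a - p) := by omega
      simp only [hM, vsk, this, if_false]
      congr 3; omega
    have f3 : ∏ x ∈ range (a - p), ((b + c - 1 + a - 1 - M x).factorial : ℚ)⁻¹ =
        ∏ k ∈ range (a - p), ((b + (p + (a - p - 1 - k))).factorial : ℚ)⁻¹ := by
      apply prod_congr rfl
      intro i hi
      rw [mem_range] at hi
      simp only [hM, vsk, hi, if_true]
      congr 3; omega
    have f4 : ∏ x ∈ range p, ((b + c - 1 + a - 1 - M (a - p + x)).factorial : ℚ)⁻¹ =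
        ∏ x ∈ range p, ((b - 1 + (p - 1 - x)).factorial : ℚ)⁻¹ := by
      apply prod_congr rfl
      intro i hi
      rw [mem_range] at hi
      have : ¬ (a - p + i < a - p) := by omega
      simp only [hM, vsk, this, if_false]
      congr 3; omega
    rw [f1, f2, f3, f4]
    ring
  rw [e3]
  have e4 : ∏ j ∈ range a, ∏ i ∈ range j, ((vsk (a - p) j : ℚ) - vsk (a - p) i) =
      (∏ i ∈ range a, (i.factorial : ℚ)) * (poch ((a : ℚ) - p + 1) p / (p.factorial : ℚ)) := by
    have hpo := poch_eq a p hp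
    rw [Nat.sub_sub_self hp, ← hpo] at hv
    have h4 : (p.factorial : ℚ) ≠ 0 := by exact_mod_cast Nat.factorial_ne_zero _
    have h5 : ((a - p).factorial : ℚ) ≠ 0 := by exact_mod_cast Nat.factorial_ne_zero _
    rw [← mul_div_assoc, eq_div_iff h4]
    apply mul_right_cancel₀ h5
    linear_combination hv
  rw [e4, ← prod_range_mul_prod_Ico (fun i => (i.factorial : ℚ)) hp,
    ← prod_range_mul_prod_Ico (fun i => ((b + c - 1 + i).factorial : ℚ)) hp]
  simp only [div_eq_mul_inv, one_mul, prod_mul_distrib]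
  ring
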